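/- Let T ∈ (0,∞], y₀ > 0, and let X, Y : [0,T) → ℝ be continuous with Y(t) > 0 for all t, Y(0) = y₀, and Y differentiable with Y′(t) = −2 Y(t)/(X(t)² + Y(t)²). Define u(t) = ∫₀ᵗ (X(s)² + Y(s)²)⁻¹ ds, assume u(t) → ∞ as t → T⁻, let v : [0,∞) → [0,T) be the inverse of u, and set V_s = arcsinh(X(v(s))/Y(v(s))). Then ∫₀^T |X(t)|/(X(t)² + Y(t)²) dt = y₀ ∫₀^∞ e^{−2s} |sinh(V_s)| ds. -/

import Mathlib

open Set Filter Topology ENNReal MeasureTheory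

noncomputable section

/-- The time domain `[0, T)` for a lifetime `T ∈ (0,∞]`. -/
def domT (T : ℝ≥0∞) : Set ℝ := {t : ℝ | 0 ≤ t ∧ ENNReal.ofReal t < T}

/-- The filter of times `t → T⁻` (i.e. `t → ∞` when `T = ∞`). -/
def leftLimFilter (T : ℝ≥0∞) : Filter ℝ := if T = ⊤ then atTop else 𝓝[<] T.toReal

theorem domT_exists_gt {T : ℝ≥0∞} {t : ℝ} (ht : t ∈ domT T) : ∃ b ∈ domT T, t < b := by
  obtain ⟨h0, h1⟩ := ht
  obtain ⟨c, hc1, hc2⟩ := exists_between h1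
  have hc : c ≠ ⊤ := ne_top_of_lt hc2
  refine ⟨c.toReal, ⟨ENNReal.toReal_nonneg, by rwa [ENNReal.ofReal_toReal hc]⟩, ?_⟩
  exact (ENNReal.ofReal_lt_iff_lt_toReal h0 hc).1 hc1

theorem domT_ordConnected (T : ℝ≥0∞) : (domT T).OrdConnected := by
  refine ⟨fun a ha b hb x hx => ⟨ha.1.trans hx.1, ?_⟩⟩
  exact (ENNReal.ofReal_le_ofReal hx.2).trans_lt hb.2

theorem hasDeriv_primitive {T : ℝ≥0∞} {f : ℝ → ℝ} (hf : ContinuousOn f (domT T))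
    {t : ℝ} (ht : t ∈ domT T) :
    HasDerivWithinAt (fun x => ∫ s in (0:ℝ)..x, f s) (f t) (domT T) t := by
  obtain ⟨b, hb, htb⟩ := domT_exists_gt ht
  have h0b : 0 ≤ b := hb.1
  have h0 : (0:ℝ) ∈ domT T := ⟨le_rfl, lt_of_le_of_lt (by simp) ht.2⟩
  have hmem : ∀ s, max 0 (min s b) ∈ domT T := fun s =>
    (domT_ordConnected T).out h0 hb ⟨le_max_left _ _, max_le h0b (min_le_right _ _)⟩
  set F : ℝ → ℝ := fun s => f (max 0 (min s b)) with hF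
  have hFc : Continuous F := hf.comp_continuous (by fun_prop) hmem
  have hFeq : ∀ s ∈ Icc 0 b, F s = f s := by
    intro s hs
    simp [hF, hs.1, hs.2]
  have hd : HasDerivAt (fun x => ∫ s in (0:ℝ)..x, F s) (F t) t :=
    intervalIntegral.integral_hasDerivAt_right (hFc.intervalIntegrable _ _)
      hFc.aestronglyMeasurable.stronglyMeasurableAtFilter hFc.continuousAt
  rw [hFeq t ⟨ht.1, htb.le⟩] at hd
  have hev : ∀ x ∈ Icc 0 b, (∫ s in (0:ℝ)..x, f s) = ∫ s in (0:ℝ)..x, F s := by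
    intro x hx
    refine intervalIntegral.integral_congr fun s hs => ?_
    rw [uIcc_of_le hx.1] at hs
    exact (hFeq s ⟨hs.1, hs.2.trans hx.2⟩).symm
  refine hd.hasDerivWithinAt.congr_of_eventuallyEq ?_ (hev t ⟨ht.1, htb.le⟩)
  filter_upwards [self_mem_nhdsWithin, mem_nhdsWithin_of_mem_nhds (Iio_mem_nhds htb)] with x hx hx2
  exact hev x ⟨hx.1, (le_of_lt hx2)⟩

/-- The identity `∫₀^T |X_t|/(X_t²+Y_t²) dt = y₀ ∫₀^∞ e^{−2s} |sinh(V_s)| ds` from the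
proof of Proposition 3.1 (i), under the same time change as formula (16). -/
theorem loewner_drift_time_change
    (T : ℝ≥0∞) (hT : 0 < T) (y₀ : ℝ) (hy₀ : 0 < y₀)
    (X Y : ℝ → ℝ)
    (hXc : ContinuousOn X (domT T)) (hYc : ContinuousOn Y (domT T))
    (hYpos : ∀ t ∈ domT T, 0 < Y t) (hY0 : Y 0 = y₀)
    (hYder : ∀ t ∈ domT T,
      HasDerivWithinAt Y (-2 * Y t / (X t ^ 2 + Y t ^ 2)) (domT T) t)
    (U : ℝ → ℝ) (hU : U = fun t => ∫ s in (0:ℝ)..t, (X s ^ 2 + Y s ^ 2)⁻¹)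
    (hUtop : Tendsto U (leftLimFilter T) atTop)
    (v : ℝ → ℝ)
    (hvmem : ∀ s : ℝ, 0 ≤ s → v s ∈ domT T)
    (hUv : ∀ s : ℝ, 0 ≤ s → U (v s) = s)
    (hvU : ∀ t ∈ domT T, v (U t) = t)
    (hvmono : StrictMonoOn v (Ici (0:ℝ)))
    (hvcont : ContinuousOn v (Ici (0:ℝ)))
    (V : ℝ → ℝ) (hV : V = fun s => Real.arsinh (X (v s) / Y (v s))) :
    ∫⁻ t in domT T, ENNReal.ofReal (|X t| / (X t ^ 2 + Y t ^ 2))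
      = ENNReal.ofReal y₀ *
        ∫⁻ s in Set.Ioi (0:ℝ), ENNReal.ofReal (Real.exp (-2 * s) * |Real.sinh (V s)|) := by
  have h0 : (0:ℝ) ∈ domT T := ⟨le_rfl, by simpa using hT⟩
  have hQ : ∀ t ∈ domT T, 0 < X t ^ 2 + Y t ^ 2 := fun t ht => by
    have := hYpos t ht
    positivity
  have hUd : ∀ t ∈ domT T, HasDerivWithinAt U ((X t ^ 2 + Y t ^ 2)⁻¹) (domT T) t := by
    intro t ht
    rw [hU]
    exact hasDeriv_primitive (f := fun s => (X s ^ 2 + Y s ^ 2)⁻¹)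
      (((hXc.pow 2).add (hYc.pow 2)).inv₀ fun t ht => (hQ t ht).ne') ht
  have hU0 : U 0 = 0 := by simp [hU]
  have hYU : ∀ t ∈ domT T, Y t * Real.exp (2 * U t) = y₀ := by
    intro t ht
    have key := (domT_ordConnected T).convex.norm_image_sub_le_of_norm_hasDerivWithin_le
      (f := fun t => Y t * Real.exp (2 * U t)) (f' := fun _ => (0:ℝ)) (C := 0)
      (fun x hx => by
        have h := (hYder x hx).mul (((hUd x hx).const_mul 2).exp)
        refine h.congr_deriv ?_
        have := (hQ x hx).ne'
        field_simp
        ring) (by simp) h0 ht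
    simp only [hU0, hY0, zero_mul, norm_le_zero_iff, mul_zero, Real.exp_zero, mul_one] at key
    linarith
  have himg : U '' domT T = Ici 0 := by
    ext s
    constructor
    · rintro ⟨t, ht, rfl⟩
      rw [hU]
      exact intervalIntegral.integral_nonneg ht.1 fun s _ => by positivity
    · intro hs
      exact ⟨v s, hvmem s hs, hUv s hs⟩
  have hinj : InjOn U (domT T) := fun a ha b hb hab => by
    rw [← hvU a ha, ← hvU b hb, hab]
  have hmeas : MeasurableSet (domT T) := (domT_ordConnected T).measurableSet
  rw [setLIntegral_congr Ioi_ae_eq_Ici, ← himg,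
    lintegral_image_eq_lintegral_abs_deriv_mul hmeas hUd hinj,
    ← lintegral_const_mul' _ _ ENNReal.ofReal_ne_top]
  refine setLIntegral_congr_fun hmeas fun t ht => ?_
  have hq := hQ t ht
  have hy := hYpos t ht
  simp only [hV, hvU t ht, Real.sinh_arsinh]
  rw [← ENNReal.ofReal_mul (abs_nonneg _), ← ENNReal.ofReal_mul hy₀.le]
  congr 1
  rw [abs_of_pos (inv_pos.2 hq), abs_div, abs_of_pos hy, ← hYU t ht]
  have he : Real.exp (2 * U t) * Real.exp (-2 * U t) = 1 := by
    rw [← Real.exp_add]; simp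
  calc |X t| / (X t ^ 2 + Y t ^ 2)
      = (Real.exp (2 * U t) * Real.exp (-2 * U t)) * (|X t| / (X t ^ 2 + Y t ^ 2)) := by
        rw [he, one_mul]
    _ = _ := by field_simp
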